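/- Consider the Liebscher copula C̃ built from bivariate copulas C₁,…,C_K. Assume each g_j^{(k)} is differentiable at 1 with derivative d_j^{(k)}, that for each k the upper tail dependence function Λ^U_k(x,y) := x + y + lim_{ε→0⁺} (C_k(1−εx, 1−εy) − 1)/ε exists for all x, y ≥ 0, and that additionally d_1^{(k)} = d_2^{(k)} =: d^{(k)} for every k. Then ∑_{k=1}^K d^{(k)} = 1 and, for all x, y ≥ 0, the upper tail dependence function of C̃ satisfies x + y + lim_{ε→0⁺} (C̃(1−εx, 1−εy) − 1)/ε = ∑_{k=1}^K d^{(k)} Λ^U_k(x, y). -/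

import Mathlib

open Set Filter

/-- A bivariate copula: maps `[0,1]²` into `[0,1]`, has the copula boundary conditions,
and is 2-increasing. -/
def IsCopula2 (C : ℝ → ℝ → ℝ) : Prop :=
  (∀ u ∈ Set.Icc (0:ℝ) 1, ∀ v ∈ Set.Icc (0:ℝ) 1, C u v ∈ Set.Icc (0:ℝ) 1) ∧
  (∀ u ∈ Set.Icc (0:ℝ) 1, C u 0 = 0) ∧
  (∀ v ∈ Set.Icc (0:ℝ) 1, C 0 v = 0) ∧
  (∀ u ∈ Set.Icc (0:ℝ) 1, C u 1 = u) ∧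
  (∀ v ∈ Set.Icc (0:ℝ) 1, C 1 v = v) ∧
  (∀ u₁ u₂ v₁ v₂ : ℝ, 0 ≤ u₁ → u₁ ≤ u₂ → u₂ ≤ 1 → 0 ≤ v₁ → v₁ ≤ v₂ → v₂ ≤ 1 →
    0 ≤ C u₂ v₂ - C u₂ v₁ - C u₁ v₂ + C u₁ v₁)

/-- The data of Liebscher's construction: bivariate copulas `C₁,…,C_K` together with
monotone increasing functions `g_j^{(k)} : [0,1] → [0,1]` (j = 1,2) with `g_j^{(k)}(0)=0`,
`g_j^{(k)}(1)=1` and `∏_k g_j^{(k)}(u) = u` on `[0,1]`. -/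
structure LiebscherSetup (K : ℕ) where
  C : Fin K → ℝ → ℝ → ℝ
  g₁ : Fin K → ℝ → ℝ
  g₂ : Fin K → ℝ → ℝ
  copula : ∀ k, IsCopula2 (C k)
  mono₁ : ∀ k, MonotoneOn (g₁ k) (Set.Icc 0 1)
  mono₂ : ∀ k, MonotoneOn (g₂ k) (Set.Icc 0 1)
  maps₁ : ∀ k, Set.MapsTo (g₁ k) (Set.Icc 0 1) (Set.Icc 0 1)
  maps₂ : ∀ k, Set.MapsTo (g₂ k) (Set.Icc 0 1) (Set.Icc 0 1)
  zero₁ : ∀ k, g₁ k 0 = 0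
  zero₂ : ∀ k, g₂ k 0 = 0
  one₁ : ∀ k, g₁ k 1 = 1
  one₂ : ∀ k, g₂ k 1 = 1
  prodId₁ : ∀ u ∈ Set.Icc (0:ℝ) 1, ∏ k, g₁ k u = u
  prodId₂ : ∀ u ∈ Set.Icc (0:ℝ) 1, ∏ k, g₂ k u = u

/-- The Liebscher copula `C̃(u,v) = ∏_k C_k(g₁^{(k)}(u), g₂^{(k)}(v))`. -/
def LiebscherSetup.Ct {K : ℕ} (L : LiebscherSetup K) (u v : ℝ) : ℝ :=
  ∏ k, L.C k (L.g₁ k u) (L.g₂ k v)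

theorem IsCopula2.flip {C : ℝ → ℝ → ℝ} (h : IsCopula2 C) : IsCopula2 fun u v => C v u := by
  obtain ⟨h01, hu0, h0v, hu1, h1v, hinc⟩ := h
  refine ⟨fun u hu v hv => h01 v hv u hu, h0v, hu0, h1v, hu1, ?_⟩
  intro u₁ u₂ v₁ v₂ h1 h2 h3 h4 h5 h6
  linarith [hinc v₁ v₂ u₁ u₂ h4 h5 h6 h1 h2 h3]

theorem IsCopula2.abs_sub_left_le {C : ℝ → ℝ → ℝ} (h : IsCopula2 C) {u u' v : ℝ}
    (hu : u ∈ Icc (0 : ℝ) 1) (hu' : u' ∈ Icc (0 : ℝ) 1) (hv : v ∈ Icc (0 : ℝ) 1) :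
    |C u v - C u' v| ≤ |u - u'| := by
  wlog hle : u' ≤ u generalizing u u'
  · rw [abs_sub_comm, abs_sub_comm u]
    exact this hu' hu (le_of_not_ge hle)
  obtain ⟨-, hu0, -, hu1, -, hinc⟩ := h
  have hlow := hinc u' u 0 v hu'.1 hle hu.2 le_rfl hv.1 hv.2
  have hupp := hinc u' u v 1 hu'.1 hle hu.2 hv.1 hv.2 le_rfl
  rw [hu0 u hu, hu0 u' hu'] at hlow
  rw [hu1 u hu, hu1 u' hu'] at hupp
  rw [abs_of_nonneg (by linarith), abs_of_nonneg (by linarith)]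
  linarith

theorem IsCopula2.abs_sub_le {C : ℝ → ℝ → ℝ} (h : IsCopula2 C) {u u' v v' : ℝ}
    (hu : u ∈ Icc (0 : ℝ) 1) (hu' : u' ∈ Icc (0 : ℝ) 1)
    (hv : v ∈ Icc (0 : ℝ) 1) (hv' : v' ∈ Icc (0 : ℝ) 1) :
    |C u v - C u' v'| ≤ |u - u'| + |v - v'| :=
  (_root_.abs_sub_le _ (C u' v) _).trans
    (add_le_add (h.abs_sub_left_le hu hu' hv) (h.flip.abs_sub_left_le hv hv' hu'))

/-- The right derivative at `0` of a copula along a curve starting at `(1, 1)` depends only on the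
right derivative of the curve. -/
theorem IsCopula2.hasDerivWithinAt_congr_curve {C : ℝ → ℝ → ℝ} (h : IsCopula2 C)
    {a a' b b' : ℝ → ℝ} {α β D : ℝ}
    (ha : HasDerivWithinAt a α (Ici 0) 0) (ha' : HasDerivWithinAt a' α (Ici 0) 0)
    (hb : HasDerivWithinAt b β (Ici 0) 0) (hb' : HasDerivWithinAt b' β (Ici 0) 0)
    (ha0 : a 0 = a' 0) (hb0 : b 0 = b' 0)
    (hamem : ∀ᶠ ε in nhdsWithin 0 (Ici 0), a ε ∈ Icc (0 : ℝ) 1)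
    (hamem' : ∀ᶠ ε in nhdsWithin 0 (Ici 0), a' ε ∈ Icc (0 : ℝ) 1)
    (hbmem : ∀ᶠ ε in nhdsWithin 0 (Ici 0), b ε ∈ Icc (0 : ℝ) 1)
    (hbmem' : ∀ᶠ ε in nhdsWithin 0 (Ici 0), b' ε ∈ Icc (0 : ℝ) 1)
    (hD : HasDerivWithinAt (fun ε => C (a' ε) (b' ε)) D (Ici 0) 0) :
    HasDerivWithinAt (fun ε => C (a ε) (b ε)) D (Ici 0) 0 := by
  have hda := (ha.sub ha').isLittleO
  have hdb := (hb.sub hb').isLittleO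
  simp only [Pi.sub_apply, ha0, hb0, sub_self, sub_zero, smul_zero] at hda hdb
  have hdiff : HasDerivWithinAt (fun ε => C (a ε) (b ε) - C (a' ε) (b' ε)) 0 (Ici 0) 0 := by
    refine HasDerivWithinAt.of_isLittleO ?_
    simp only [ha0, hb0, sub_self, sub_zero, smul_zero]
    refine Asymptotics.IsBigO.trans_isLittleO (.of_bound' ?_) (hda.norm_left.add hdb.norm_left)
    filter_upwards [hamem, hamem', hbmem, hbmem'] with ε h1 h2 h3 h4
    simp only [Real.norm_eq_abs]
    exact (h.abs_sub_le h1 h2 h3 h4).trans (le_abs_self _)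
  convert! hdiff.add hD using 1
  · ext ε; simp
  · simp

theorem hasDerivWithinAt_Ici_zero_iff {f : ℝ → ℝ} {D : ℝ} (hf : f 0 = 1) :
    HasDerivWithinAt f D (Ici 0) 0 ↔
      Tendsto (fun ε => (f ε - 1) / ε) (nhdsWithin 0 (Ioi 0)) (nhds D) := by
  rw [← hasDerivWithinAt_Ioi_iff_Ici, hasDerivWithinAt_iff_tendsto_slope' self_notMem_Ioi]
  have : slope f 0 = fun ε => (f ε - 1) / ε := by
    ext ε
    simp [slope_def_field, hf]
  rw [this]

theorem hasDerivWithinAt_finsetProd_of_eq_one {ι : Type*} [Fintype ι] {f : ι → ℝ → ℝ}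
    {f' : ι → ℝ} {s : Set ℝ} {t : ℝ} (hf : ∀ i, HasDerivWithinAt (f i) (f' i) s t)
    (h1 : ∀ i, f i t = 1) : HasDerivWithinAt (fun r => ∏ i, f i r) (∑ i, f' i) s t := by
  classical
  simpa [h1] using HasDerivWithinAt.fun_finsetProd (u := Finset.univ) fun i _ => hf i

theorem eventually_one_sub_mul_mem_Icc {x : ℝ} (hx : 0 ≤ x) :
    ∀ᶠ ε in nhdsWithin (0 : ℝ) (Ici 0), 1 - ε * x ∈ Icc (0 : ℝ) 1 := by
  have hpos : ∀ᶠ ε in nhdsWithin (0 : ℝ) (Ici 0), 0 < 1 - ε * x :=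
    nhdsWithin_le_nhds <| (show Continuous fun ε : ℝ => 1 - ε * x by fun_prop).continuousAt.eventually
      (lt_mem_nhds (by simp))
  filter_upwards [hpos, self_mem_nhdsWithin] with ε h1 h2
  exact ⟨h1.le, sub_le_self _ (mul_nonneg h2 hx)⟩

theorem hasDerivWithinAt_one_sub_mul (x : ℝ) (s : Set ℝ) (t : ℝ) :
    HasDerivWithinAt (fun ε : ℝ => 1 - ε * x) (-x) s t := by
  simpa using ((hasDerivWithinAt_id t s).mul_const x).const_sub 1

theorem HasDerivWithinAt.comp_one_sub_mul {g : ℝ → ℝ} {d x : ℝ}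
    (hg : HasDerivWithinAt g d (Icc 0 1) 1) (hx : 0 ≤ x) :
    HasDerivWithinAt (fun ε => g (1 - ε * x)) (-(d * x)) (Ici 0) 0 := by
  have hmem := eventually_one_sub_mul_mem_Icc hx
  have hcomp : HasDerivWithinAt (fun ε => g (1 - ε * x)) (d * -x)
      ((fun ε => 1 - ε * x) ⁻¹' Icc 0 1) 0 :=
    HasDerivWithinAt.comp (h := fun ε : ℝ => 1 - ε * x) 0 (by simpa using hg)
      (hasDerivWithinAt_one_sub_mul x _ 0) (mapsTo_preimage _ _)
  rw [← mul_neg]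
  exact hcomp.mono_of_mem_nhdsWithin hmem

theorem HasDerivWithinAt.nonneg_of_monotoneOn_Icc {g : ℝ → ℝ} {d : ℝ}
    (hg : HasDerivWithinAt g d (Icc 0 1) 1) (hmono : MonotoneOn g (Icc 0 1)) : 0 ≤ d :=
  hg.nonneg_of_monotoneOn
    ((uniqueDiffOn_Icc (zero_lt_one' ℝ)) 1 (right_mem_Icc.2 zero_le_one)).accPt hmono

/-- Chain rule for the directional derivative of a copula at `(1, 1)`, along a pair of marginal
transformations with the same derivative at `1`. -/
theorem IsCopula2.hasDerivWithinAt_comp {C : ℝ → ℝ → ℝ} (h : IsCopula2 C) {g₁ g₂ : ℝ → ℝ}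
    {d x y D : ℝ} (hg₁ : HasDerivWithinAt g₁ d (Icc 0 1) 1)
    (hg₂ : HasDerivWithinAt g₂ d (Icc 0 1) 1) (hmaps₁ : MapsTo g₁ (Icc 0 1) (Icc 0 1))
    (hmaps₂ : MapsTo g₂ (Icc 0 1) (Icc 0 1)) (hone₁ : g₁ 1 = 1) (hone₂ : g₂ 1 = 1)
    (hd : 0 ≤ d) (hx : 0 ≤ x) (hy : 0 ≤ y)
    (hD : HasDerivWithinAt (fun ε => C (1 - ε * x) (1 - ε * y)) D (Ici 0) 0) :
    HasDerivWithinAt (fun ε => C (g₁ (1 - ε * x)) (g₂ (1 - ε * y))) (d * D) (Ici 0) 0 := by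
  refine h.hasDerivWithinAt_congr_curve (hg₁.comp_one_sub_mul hx)
    (hasDerivWithinAt_one_sub_mul (d * x) _ _) (hg₂.comp_one_sub_mul hy)
    (hasDerivWithinAt_one_sub_mul (d * y) _ _) (by simpa) (by simpa)
    ((eventually_one_sub_mul_mem_Icc hx).mono fun _ hε => hmaps₁ hε)
    (eventually_one_sub_mul_mem_Icc (mul_nonneg hd hx))
    ((eventually_one_sub_mul_mem_Icc hy).mono fun _ hε => hmaps₂ hε)
    (eventually_one_sub_mul_mem_Icc (mul_nonneg hd hy)) ?_
  have hscale : HasDerivWithinAt (fun ε : ℝ => ε * d) d (Ici 0) 0 := by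
    simpa using (hasDerivWithinAt_id (0 : ℝ) (Ici 0)).mul_const d
  have hcomp := HasDerivWithinAt.comp (h := fun ε : ℝ => ε * d) (s' := Ici 0) 0
    (by simpa using hD) hscale fun ε hε => mul_nonneg hε hd
  simpa [Function.comp_def, mul_assoc, mul_comm D] using hcomp

/-- **Upper tail dependence function of a Liebscher copula, particular case.**
Under the assumptions of the general upper-tail result, if additionally
`d₁^{(k)} = d₂^{(k)} = d^{(k)}` for every `k`, then `∑_k d^{(k)} = 1` and the upper tail
dependence function of `C̃` is the convex combination `(x,y) ↦ ∑_k d^{(k)} Λ^U_k(x,y)`. -/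
theorem liebscher_upper_tail_particular (K : ℕ) (hK : 1 ≤ K) (L : LiebscherSetup K)
    (d₁ d₂ : Fin K → ℝ)
    (hd₁ : ∀ k, HasDerivWithinAt (L.g₁ k) (d₁ k) (Set.Icc 0 1) 1)
    (hd₂ : ∀ k, HasDerivWithinAt (L.g₂ k) (d₂ k) (Set.Icc 0 1) 1)
    (hdeq : ∀ k, d₁ k = d₂ k)
    (ΛU : Fin K → ℝ → ℝ → ℝ)
    (hΛU : ∀ k, ∀ x ≥ (0:ℝ), ∀ y ≥ (0:ℝ),
      Filter.Tendsto (fun ε => (L.C k (1 - ε * x) (1 - ε * y) - 1) / ε)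
        (nhdsWithin 0 (Set.Ioi 0)) (nhds (ΛU k x y - x - y))) :
    (∑ k, d₁ k = 1) ∧
    ∀ x ≥ (0:ℝ), ∀ y ≥ (0:ℝ),
      Filter.Tendsto (fun ε => (L.Ct (1 - ε * x) (1 - ε * y) - 1) / ε)
        (nhdsWithin 0 (Set.Ioi 0))
        (nhds ((∑ k, d₁ k * ΛU k x y) - x - y)) := by
  have hsum : ∑ k, d₁ k = 1 := by
    have hone : (1 : ℝ) ∈ Icc (0 : ℝ) 1 := right_mem_Icc.2 zero_le_one
    refine UniqueDiffWithinAt.eq_deriv _ (uniqueDiffOn_Icc zero_lt_one 1 hone)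
      (hasDerivWithinAt_finsetProd_of_eq_one hd₁ L.one₁) ?_
    exact (hasDerivWithinAt_id _ _).congr L.prodId₁ (L.prodId₁ 1 hone)
  refine ⟨hsum, fun x hx y hy => ?_⟩
  have hC1 : ∀ k, L.C k 1 1 = 1 := fun k =>
    (L.copula k).2.2.2.1 1 (right_mem_Icc.2 zero_le_one)
  have hlim : ∑ k, d₁ k * (ΛU k x y - x - y) = (∑ k, d₁ k * ΛU k x y) - x - y := by
    simp only [mul_sub, Finset.sum_sub_distrib, ← Finset.sum_mul, hsum, one_mul]
  rw [← hlim]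
  refine (hasDerivWithinAt_Ici_zero_iff (f := fun ε => L.Ct (1 - ε * x) (1 - ε * y))
    (by simp [LiebscherSetup.Ct, L.one₁, L.one₂, hC1])).1 ?_
  refine hasDerivWithinAt_finsetProd_of_eq_one (fun k => ?_)
    (fun k => by simp [L.one₁, L.one₂, hC1])
  refine (L.copula k).hasDerivWithinAt_comp (hd₁ k) (hdeq k ▸ hd₂ k) (L.maps₁ k) (L.maps₂ k)
    (L.one₁ k) (L.one₂ k) ((hd₁ k).nonneg_of_monotoneOn_Icc (L.mono₁ k)) hx hy ?_
  exact (hasDerivWithinAt_Ici_zero_iff (by simp [hC1])).2 (hΛU k x hx y hy)
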